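/- The matrix H_d = (A(d,i,j))_{0≤i,j≤d−1}, where A(d,i,j) counts permutations of {1,…,d} with i descents and last entry d−j, is TP₂: all entries and all 2×2 minors are non-negative. -/

import Mathlib

/-- The number of descents of a permutation of `Fin d`:
indices `k` with `σ(k) > σ(k+1)`. -/
def descentCount {d : ℕ} (σ : Equiv.Perm (Fin d)) : ℕ :=
  (Finset.univ.filter
    (fun k : Fin d => ∃ l : Fin d, (l : ℕ) = (k : ℕ) + 1 ∧ σ l < σ k)).card

/-- `A d i j` is the number of permutations `σ` of `{1,…,d}` (modeled on `Fin d`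
with values shifted down by one) with exactly `i` descents and `σ(d) = d - j`,
i.e. the last value (0-based) satisfies `σ(last) + j = d - 1`.  In particular
`A d i j = 0` whenever `i ≥ d` or `j ≥ d`. -/
def permCount (d i j : ℕ) : ℕ :=
  (Finset.univ.filter (fun σ : Equiv.Perm (Fin d) =>
    descentCount σ = i ∧
    ∃ k : Fin d, (k : ℕ) = d - 1 ∧ (σ k : ℕ) + j = d - 1)).card

/-- The permutation of `Fin (n + 1)` with last value `p` whose other values form the pattern `τ`. -/
def appendPerm {n : ℕ} (p : Fin (n + 1)) (τ : Equiv.Perm (Fin n)) : Equiv.Perm (Fin (n + 1)) :=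
  ((finSuccEquiv' (Fin.last n)).trans (Equiv.optionCongr τ)).trans (finSuccEquiv' p).symm

lemma appendPerm_last {n : ℕ} (p : Fin (n + 1)) (τ : Equiv.Perm (Fin n)) :
    appendPerm p τ (Fin.last n) = p := by
  simp [appendPerm]

lemma appendPerm_castSucc {n : ℕ} (p : Fin (n + 1)) (τ : Equiv.Perm (Fin n)) (k : Fin n) :
    appendPerm p τ k.castSucc = p.succAbove (τ k) := by
  have h : finSuccEquiv' (Fin.last n) k.castSucc = some k := by
    rw [← Fin.succAbove_last]
    exact finSuccEquiv'_succAbove _ _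
  simp [appendPerm, h]

lemma appendPerm_bijective (n : ℕ) :
    Function.Bijective
      (fun x : Fin (n + 1) × Equiv.Perm (Fin n) => appendPerm x.1 x.2) := by
  rw [Fintype.bijective_iff_injective_and_card]
  refine ⟨?_, by simp [Fintype.card_perm, Nat.factorial_succ]⟩
  rintro ⟨p, τ⟩ ⟨q, υ⟩ h
  have hpq : p = q := by
    have := congrArg (fun σ => σ (Fin.last n)) h
    simpa only [appendPerm_last] using this
  subst hpq
  refine Prod.ext rfl (Equiv.ext fun k => ?_)
  have := congrArg (fun σ => σ k.castSucc) h
  simpa only [appendPerm_castSucc, Fin.succAbove_right_inj] using this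

lemma descentCount_eq_sum {m : ℕ} (σ : Equiv.Perm (Fin (m + 1))) :
    descentCount σ = ∑ k : Fin m, if σ k.succ < σ k.castSucc then 1 else 0 := by
  rw [descentCount, Finset.card_filter, Fin.sum_univ_castSucc, if_neg, add_zero]
  · refine Finset.sum_congr rfl fun k _ => if_congr ⟨?_, fun h => ⟨k.succ, by simp, h⟩⟩ rfl rfl
    rintro ⟨l, hl, h⟩
    have : l = k.succ := Fin.ext (by simpa using hl)
    rwa [← this]
  · rintro ⟨l, hl, -⟩
    have := l.isLt
    simp at hl
    omega

lemma descentCount_appendPerm {m : ℕ} (p : Fin (m + 2)) (τ : Equiv.Perm (Fin (m + 1))) :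
    descentCount (appendPerm p τ) =
      descentCount τ + if (p : ℕ) ≤ τ (Fin.last m) then 1 else 0 := by
  rw [descentCount_eq_sum, descentCount_eq_sum, Fin.sum_univ_castSucc]
  congr 1
  · refine Finset.sum_congr rfl fun k _ => ?_
    rw [Fin.succ_castSucc, appendPerm_castSucc, appendPerm_castSucc]
    simp only [(Fin.strictMono_succAbove p).lt_iff_lt]
  · simp only [Fin.succ_last, appendPerm_last, appendPerm_castSucc,
      Fin.lt_succAbove_iff_le_castSucc, Fin.le_def, Fin.val_castSucc]

lemma permCount_succ (m i j : ℕ) :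
    permCount (m + 1) i j = (Finset.univ.filter (fun σ : Equiv.Perm (Fin (m + 1)) =>
      descentCount σ = i ∧ (σ (Fin.last m) : ℕ) + j = m)).card := by
  rw [permCount]
  congr 1
  refine Finset.filter_congr fun σ _ => and_congr_right fun _ =>
    ⟨?_, fun h => ⟨Fin.last m, by simp, by simpa using h⟩⟩
  rintro ⟨k, hk, h⟩
  have : k = Fin.last m := Fin.ext (by simpa using hk)
  simpa [← this] using h

/-- Removing the last entry of a permutation. -/
lemma permCount_eq_card_pattern (m i j : ℕ) (hj : j ≤ m + 1) :
    permCount (m + 2) i j = (Finset.univ.filter (fun τ : Equiv.Perm (Fin (m + 1)) =>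
      descentCount τ + (if m + 1 ≤ τ (Fin.last m) + j then 1 else 0) = i)).card := by
  rw [permCount_succ]
  symm
  have hval (τ : Equiv.Perm (Fin (m + 1))) :
      (m + 1 ≤ τ (Fin.last m) + j) ↔ m + 1 - j ≤ τ (Fin.last m) := by omega
  refine Finset.card_bij (fun τ _ => appendPerm ⟨m + 1 - j, by omega⟩ τ) ?_ ?_ ?_
  · intro τ hτ
    simp only [Finset.mem_filter, Finset.mem_univ, true_and, descentCount_appendPerm,
      appendPerm_last, hval] at hτ ⊢
    exact ⟨hτ, by omega⟩
  · intro τ _ υ _ h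
    exact congrArg Prod.snd ((appendPerm_bijective (m + 1)).1 (a₁ := (_, τ)) (a₂ := (_, υ)) h)
  · intro σ hσ
    obtain ⟨⟨p, τ⟩, rfl⟩ := (appendPerm_bijective (m + 1)).2 σ
    simp only [Finset.mem_filter, Finset.mem_univ, true_and, appendPerm_last,
      descentCount_appendPerm] at hσ
    have hp : ⟨m + 1 - j, Nat.lt_succ_of_le (Nat.sub_le _ _)⟩ = p := Fin.ext (by simp; omega)
    subst hp
    refine ⟨τ, ?_, rfl⟩
    simpa only [Finset.mem_filter, Finset.mem_univ, true_and, hval] using hσ.1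

lemma permCount_recurrence (m i j : ℕ) (hj : j ≤ m + 1) :
    permCount (m + 2) i j = ∑ r ∈ Finset.range (m + 1),
      if r < j then (if 1 ≤ i then permCount (m + 1) (i - 1) r else 0)
      else permCount (m + 1) i r := by
  rw [permCount_eq_card_pattern m i j hj,
    Finset.card_eq_sum_card_fiberwise (f := fun τ => m - (τ (Fin.last m) : ℕ))
      (t := Finset.range (m + 1)) (fun τ _ => by simp)]
  refine Finset.sum_congr rfl fun r hr => ?_
  rw [Finset.mem_range] at hr
  rw [Finset.filter_filter, permCount_succ, permCount_succ]
  split_ifs with hrj hi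
  · congr 1
    refine Finset.filter_congr fun τ _ => ?_
    have := (τ (Fin.last m)).isLt
    split_ifs <;> omega
  · rw [Finset.card_eq_zero, Finset.filter_eq_empty_iff]
    intro τ _
    have := (τ (Fin.last m)).isLt
    split_ifs <;> omega
  · congr 1
    refine Finset.filter_congr fun τ _ => ?_
    have := (τ (Fin.last m)).isLt
    split_ifs <;> omega

/-- The matrix `permCount n` extended to the right by its own copies, each shifted down by one:
column `q * n + r` is column `r` shifted down by `q`. -/
def shiftedCount (n i k : ℕ) : ℕ :=
  if k / n ≤ i then permCount n (i - k / n) (k % n) else 0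

lemma shiftedCount_of_lt {n k : ℕ} (i : ℕ) (hk : k < n) :
    shiftedCount n i k = permCount n i k := by
  simp [shiftedCount, Nat.div_eq_of_lt hk, Nat.mod_eq_of_lt hk]

lemma shiftedCount_mul_add {n : ℕ} (hn : 0 < n) (i q k : ℕ) :
    shiftedCount n i (q * n + k) = if q ≤ i then shiftedCount n (i - q) k else 0 := by
  have hdiv : (q * n + k) / n = q + k / n := by
    rw [add_comm, Nat.add_mul_div_right _ _ hn, add_comm]
  have hmod : (q * n + k) % n = k % n := by simp
  simp only [shiftedCount, hdiv, hmod, Nat.sub_add_eq]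
  generalize k / n = c
  split_ifs <;> first | rfl | omega

lemma permCount_eq_sum_shiftedCount (m i j : ℕ) (hj : j ≤ m + 1) :
    permCount (m + 2) i j = ∑ k ∈ Finset.Ico j (j + (m + 1)), shiftedCount (m + 1) i k := by
  rw [permCount_recurrence m i j hj, Finset.range_eq_Ico,
    ← Finset.sum_Ico_consecutive _ (Nat.zero_le j) hj,
    ← Finset.sum_Ico_consecutive _ hj (Nat.le_add_left (m + 1) j), add_comm]
  congr 1
  · refine Finset.sum_congr rfl fun r hr => ?_
    rw [Finset.mem_Ico] at hr
    rw [if_neg (by omega), shiftedCount_of_lt _ hr.2]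
  · have h := Finset.sum_Ico_add' (shiftedCount (m + 1) i) 0 j (m + 1)
    rw [zero_add] at h
    rw [← h]
    refine Finset.sum_congr rfl fun r hr => ?_
    rw [Finset.mem_Ico] at hr
    have hs := shiftedCount_mul_add (Nat.succ_pos m) i 1 r
    rw [one_mul, add_comm] at hs
    rw [if_pos hr.2, hs, shiftedCount_of_lt _ (by omega)]

lemma shiftedCount_succ (m i k : ℕ) :
    shiftedCount (m + 2) i k =
      ∑ l ∈ Finset.Ico (k / (m + 2) * (m + 1) + k % (m + 2))
        (k / (m + 2) * (m + 1) + k % (m + 2) + (m + 1)), shiftedCount (m + 1) i l := by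
  have hk : k % (m + 2) ≤ m + 1 := Nat.le_of_lt_succ (Nat.mod_lt _ (by omega))
  rw [add_assoc, Nat.add_comm (_ * _) (_ % _), Nat.add_comm (_ * _) (_ + _),
    ← Finset.sum_Ico_add]
  simp only [shiftedCount_mul_add (Nat.succ_pos m)]
  rw [shiftedCount]
  split_ifs
  · exact permCount_eq_sum_shiftedCount _ _ _ hk
  · simp

lemma windowStart_mono (m : ℕ) :
    Monotone fun k => k / (m + 2) * (m + 1) + k % (m + 2) := by
  have h (k : ℕ) : k / (m + 2) * (m + 1) + k % (m + 2) + k / (m + 2) = k := by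
    conv_rhs => rw [← Nat.div_add_mod k (m + 2)]
    ring
  refine monotone_nat_of_le_succ fun k => ?_
  have h₁ := h k
  have h₂ := h (k + 1)
  have h₃ : (k + 1) / (m + 2) ≤ k / (m + 2) + 1 := by
    rw [Nat.succ_div]
    split_ifs <;> omega
  omega

lemma sum_mul_sum_le_of_forall_le {f g : ℕ → ℕ} {s t : Finset ℕ}
    (h : ∀ k ∈ s, ∀ l ∈ t, f l * g k ≤ f k * g l) :
    (∑ l ∈ t, f l) * ∑ k ∈ s, g k ≤ (∑ k ∈ s, f k) * ∑ l ∈ t, g l := by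
  rw [Finset.sum_mul_sum, Finset.sum_mul_sum, Finset.sum_comm]
  exact Finset.sum_le_sum fun k hk => Finset.sum_le_sum fun l hl => h k hk l hl

/-- Summing over sliding windows preserves non-negativity of the `2 × 2` minors. -/
lemma window_sum_mul_le {f g : ℕ → ℕ} (h : ∀ k l, k ≤ l → f l * g k ≤ f k * g l)
    (n : ℕ) {a b : ℕ} (hab : a ≤ b) :
    (∑ k ∈ Finset.Ico b (b + n), f k) * ∑ k ∈ Finset.Ico a (a + n), g k ≤
      (∑ k ∈ Finset.Ico a (a + n), f k) * ∑ k ∈ Finset.Ico b (b + n), g k := by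
  set s := Finset.Ico a (a + n) with hs
  set t := Finset.Ico b (b + n) with ht
  have hsplit (u : ℕ → ℕ) (s t : Finset ℕ) :
      ∑ k ∈ s, u k = ∑ k ∈ s ∩ t, u k + ∑ k ∈ s \ t, u k :=
    (Finset.sum_inter_add_sum_sdiff s t u).symm
  have h₁ := sum_mul_sum_le_of_forall_le (f := f) (g := g) (s := s \ t) (t := s ∩ t)
    fun k hk l hl => h k l (by simp [hs, ht] at hk hl; omega)
  have h₂ := sum_mul_sum_le_of_forall_le (f := f) (g := g) (s := s ∩ t) (t := t \ s)
    fun k hk l hl => h k l (by simp [hs, ht] at hk hl; omega)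
  have h₃ := sum_mul_sum_le_of_forall_le (f := f) (g := g) (s := s \ t) (t := t \ s)
    fun k hk l hl => h k l (by simp [hs, ht] at hk hl; omega)
  rw [hsplit f s t, hsplit g s t, hsplit f t s, hsplit g t s, Finset.inter_comm t s]
  nlinarith

lemma shiftedCount_one (i k : ℕ) : shiftedCount 1 i k = if i = k then 1 else 0 := by
  have h (i : ℕ) : permCount 1 i 0 = if i = 0 then 1 else 0 := by
    rw [permCount_succ]
    simp only [descentCount_eq_sum]
    split_ifs with hi
    · simp [hi]
    · simp [Ne.symm hi]
  simp only [shiftedCount, Nat.div_one, Nat.mod_one, h]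
  split_ifs <;> omega

lemma shiftedCount_TP2 (m : ℕ) {i₁ i₂ : ℕ} (hi : i₁ ≤ i₂) (k l : ℕ) (hkl : k ≤ l) :
    shiftedCount (m + 1) i₁ l * shiftedCount (m + 1) i₂ k ≤
      shiftedCount (m + 1) i₁ k * shiftedCount (m + 1) i₂ l := by
  induction m generalizing k l with
  | zero =>
    simp only [zero_add, shiftedCount_one]
    split_ifs <;> omega
  | succ m ih =>
    simp only [shiftedCount_succ]
    exact window_sum_mul_le ih (m + 1) (windowStart_mono m hkl)

theorem permCount_matrix_TP2 (d : ℕ) :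
    (∀ i j : Fin d, (0 : ℝ) ≤ (permCount d i j : ℝ)) ∧
    ∀ i₁ i₂ j₁ j₂ : Fin d, i₁ < i₂ → j₁ < j₂ →
      0 ≤ (permCount d i₁ j₁ : ℝ) * (permCount d i₂ j₂ : ℝ) -
        (permCount d i₁ j₂ : ℝ) * (permCount d i₂ j₁ : ℝ) := by
  refine ⟨fun i j => Nat.cast_nonneg _, fun i₁ i₂ j₁ j₂ hi hj => ?_⟩
  cases d with
  | zero => exact i₁.elim0
  | succ m =>
    have h := shiftedCount_TP2 m (Fin.le_def.1 hi.le) j₁ j₂ (Fin.le_def.1 hj.le)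
    simp only [shiftedCount_of_lt _ j₁.isLt, shiftedCount_of_lt _ j₂.isLt] at h
    rw [sub_nonneg]
    exact_mod_cast h
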